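/- The field ⋃_{n≥1} ℂ((t^{1/n})), the union (direct limit) of the fields of formal Laurent series in t^{1/n} over ℂ, is an algebraic closure of ℂ((t)); in particular every finite extension of ℂ((t)) is of the form ℂ((t^{1/n})) for some n, and every finite Galois extension of ℂ((t)) has cyclic Galois group. -/

import Mathlib

open Polynomial PowerSeries

/-- **Hensel-type factorization**: over a complete local ring, a monic polynomial whose reduction
vanishes at `0` but is not a power of `X` has a nontrivial monic factor. -/
theorem Polynomial.Monic.exists_monic_dvd_of_isAdicComplete {A : Type*} [CommRing A]
    [IsLocalRing A] [IsAdicComplete (IsLocalRing.maximalIdeal A) A] {f : A[X]} (hf : f.Monic)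
    (h0 : f.coeff 0 ∈ IsLocalRing.maximalIdeal A)
    (h1 : ∃ i < f.natDegree, f.coeff i ∉ IsLocalRing.maximalIdeal A) :
    ∃ P : A[X], P.Monic ∧ P ∣ f ∧ 0 < P.natDegree ∧ P.natDegree < f.natDegree := by
  have hmap : (f : A⟦X⟧).map (IsLocalRing.residue A) ≠ 0 := by
    rw [← Polynomial.polynomial_map_coe]
    exact_mod_cast f.map_monic_ne_zero (f := IsLocalRing.residue A) hf
  obtain ⟨P, h, H⟩ := PowerSeries.exists_isWeierstrassFactorization hmap
  have hPm := H.isDistinguishedAt.monic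
  have hdvd : P ∣ f := by
    rw [← Ideal.mem_span_singleton, ← Ideal.Quotient.eq_zero_iff_mem]
    apply H.isDistinguishedAt.algEquivQuotient.injective
    rw [map_zero]
    refine Ideal.Quotient.eq_zero_iff_mem.2 (Ideal.mem_span_singleton.2 ?_)
    exact ⟨h, H.eq_mul⟩
  refine ⟨P, hPm, hdvd, ?_, ?_⟩
  · rw [Nat.pos_iff_ne_zero]
    intro hP
    have hP1 : P = 1 := hPm.natDegree_eq_zero.1 hP
    have hu := H.isUnit
    have he := H.eq_mul
    rw [hP1, Polynomial.coe_one, one_mul] at he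
    rw [← he, PowerSeries.isUnit_iff_constantCoeff] at hu
    exact (IsLocalRing.mem_maximalIdeal _).1 h0 (by simpa using hu)
  · have hle : P.natDegree ≤ f.natDegree := by
      obtain ⟨Q, hQ⟩ := hdvd
      rw [hQ, hPm.natDegree_mul' fun hQ0 => hf.ne_zero (by rw [hQ, hQ0, mul_zero])]
      exact Nat.le_add_right _ _
    refine lt_of_le_of_ne hle fun hd => ?_
    have hPf : P = f := (Polynomial.eq_of_monic_of_dvd_of_natDegree_le hPm hf hdvd hd.ge).symm
    obtain ⟨i, hi, hi'⟩ := h1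
    subst hPf
    exact hi' (H.isDistinguishedAt.mem hi)

/-- The subleading coefficient after a translation. -/
theorem Polynomial.coeff_taylor_natDegree_sub_one {R : Type*} [CommRing R] {f : R[X]}
    (hf : f.Monic) (hd : f.natDegree ≠ 0) (a : R) :
    (taylor a f).coeff (f.natDegree - 1) = f.coeff (f.natDegree - 1) + f.natDegree * a := by
  obtain ⟨d, hd'⟩ := Nat.exists_eq_succ_of_ne_zero hd
  have hc : f.coeff (d + 1) = 1 := by rw [← Nat.succ_eq_add_one, ← hd']; exact hf
  have hlt : (hasseDeriv d f).natDegree < 2 :=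
    (natDegree_hasseDeriv_le f d).trans_lt (by omega)
  rw [taylor_coeff, hd', Nat.succ_sub_one, eval_eq_sum_range' hlt]
  simp [Finset.sum_range_succ, hasseDeriv_coeff, add_comm 1 d, hc]

instance PowerSeries.isAdicComplete_maximalIdeal (k : Type*) [Field k] :
    IsAdicComplete (IsLocalRing.maximalIdeal k⟦X⟧) k⟦X⟧ := by
  rw [PowerSeries.maximalIdeal_eq_span_X]
  infer_instance

theorem PowerSeries.mem_maximalIdeal_iff_constantCoeff {k : Type*} [Field k] (x : k⟦X⟧) :
    x ∈ IsLocalRing.maximalIdeal k⟦X⟧ ↔ constantCoeff x = 0 := by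
  rw [PowerSeries.maximalIdeal_eq_span_X, Ideal.mem_span_singleton, X_dvd_iff]

theorem PowerSeries.exists_monic_dvd_of_coeff_natDegree_sub_one_eq_zero {k : Type*} [Field k]
    [IsAlgClosed k] [CharZero k] {f : k⟦X⟧[X]} (hf : f.Monic)
    (h0 : f.coeff (f.natDegree - 1) = 0)
    (h1 : ∃ i < f.natDegree, constantCoeff (f.coeff i) ≠ 0) :
    ∃ P : k⟦X⟧[X], P.Monic ∧ P ∣ f ∧ 0 < P.natDegree ∧ P.natDegree < f.natDegree := by
  obtain ⟨i, hi, hi'⟩ := h1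
  have hd : f.natDegree ≠ 0 := by omega
  set g : k[X] := f.map constantCoeff with hg
  have hgm : g.Monic := hf.map _
  have hgd : g.natDegree = f.natDegree := hf.natDegree_map _
  obtain ⟨c, hc⟩ := IsAlgClosed.exists_root g (by
    rw [degree_eq_natDegree hgm.ne_zero, hgd]; exact_mod_cast hd)
  have htg : (taylor (PowerSeries.C c) f).map constantCoeff = taylor c g := by
    simp [taylor_apply, Polynomial.map_comp, hg]
  have hcoeff (j : ℕ) : constantCoeff ((taylor (PowerSeries.C c) f).coeff j) =
      (taylor c g).coeff j := by rw [← htg, Polynomial.coeff_map]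
  have hFm : (taylor (PowerSeries.C c) f).Monic := by
    simpa [taylor_apply] using hf.comp_X_add_C (PowerSeries.C c)
  obtain ⟨P, hPm, ⟨Q, hQ⟩, hP0, hP1⟩ := hFm.exists_monic_dvd_of_isAdicComplete (by
      rw [mem_maximalIdeal_iff_constantCoeff, hcoeff, taylor_coeff_zero]
      exact hc) (by
    by_contra! hall
    simp only [natDegree_taylor, mem_maximalIdeal_iff_constantCoeff, hcoeff] at hall
    have hsub := hall (f.natDegree - 1) (by omega)
    rw [← hgd, coeff_taylor_natDegree_sub_one hgm (by rwa [hgd]), hgd, hg, Polynomial.coeff_map,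
      h0, map_zero, zero_add, mul_eq_zero, Nat.cast_eq_zero, or_iff_right hd] at hsub
    have := hall i hi
    rw [hsub, taylor_zero, hg, Polynomial.coeff_map] at this
    exact hi' this)
  refine ⟨taylor (-PowerSeries.C c) P, ?_, ⟨taylor (-PowerSeries.C c) Q, ?_⟩, ?_, ?_⟩
  · simpa [taylor_apply] using hPm.comp_X_add_C (-PowerSeries.C c)
  · rw [← taylor_mul, ← hQ, taylor_taylor]
    simp
  · simpa using hP0
  · simpa using hP1

namespace LaurentSeries

section SubstPow

variable {R : Type*} [CommRing R]

/-- The endomorphism `t ↦ tⁿ` of the ring of Laurent series. -/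
noncomputable def substPow (n : ℕ+) : LaurentSeries R →+* LaurentSeries R :=
  HahnSeries.embDomainRingHom (AddMonoidHom.mulLeft (n : ℤ))
    (mul_right_injective₀ (by simp)) fun _ _ => mul_le_mul_iff_right₀ (by simp)

theorem coeff_substPow_mul (n : ℕ+) (x : LaurentSeries R) (z : ℤ) :
    (substPow n x).coeff (n * z) = x.coeff z :=
  HahnSeries.embDomain_coeff (f := ⟨⟨AddMonoidHom.mulLeft (n : ℤ), _⟩, _⟩)

theorem coeff_substPow_of_not_dvd (n : ℕ+) (x : LaurentSeries R) {z : ℤ} (hz : ¬ (n : ℤ) ∣ z) :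
    (substPow n x).coeff z = 0 :=
  HahnSeries.embDomain_of_notMem_range (by
    rintro ⟨w, rfl⟩
    exact hz ⟨w, rfl⟩)

@[simp]
theorem substPow_single (n : ℕ+) (z : ℤ) (r : R) :
    substPow n (HahnSeries.single z r) = HahnSeries.single (n * z) r :=
  HahnSeries.embDomain_single

theorem substPow_algebraMap (n : ℕ+) (r : R) :
    substPow n (algebraMap R (LaurentSeries R) r) = algebraMap R (LaurentSeries R) r := by
  simp [HahnSeries.algebraMap_apply']

@[simp]
theorem substPow_substPow (m n : ℕ+) (x : LaurentSeries R) :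
    substPow m (substPow n x) = substPow (m * n) x := by
  ext z
  by_cases hm : (m : ℤ) ∣ z
  · obtain ⟨w, rfl⟩ := hm
    rw [coeff_substPow_mul]
    by_cases hn : (n : ℤ) ∣ w
    · obtain ⟨v, rfl⟩ := hn
      rw [coeff_substPow_mul, ← mul_assoc, ← Nat.cast_mul, ← PNat.mul_coe, coeff_substPow_mul]
    · rw [coeff_substPow_of_not_dvd _ _ hn, coeff_substPow_of_not_dvd]
      rw [PNat.mul_coe, Nat.cast_mul, mul_dvd_mul_iff_left (by simp)]
      exact hn
  · rw [coeff_substPow_of_not_dvd _ _ hm, coeff_substPow_of_not_dvd]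
    exact fun h => hm ((by simp : (m : ℤ) ∣ (m * n : ℕ+)).trans h)

theorem mem_range_substPow_iff (n : ℕ+) (x : LaurentSeries R) :
    x ∈ Set.range (substPow (R := R) n) ↔ ∀ z : ℤ, ¬ (n : ℤ) ∣ z → x.coeff z = 0 := by
  refine ⟨?_, fun h => ?_⟩
  · rintro ⟨y, rfl⟩ z hz
    exact coeff_substPow_of_not_dvd n y hz
  · have hn : (0 : ℤ) < n := by simp
    refine ⟨HahnSeries.ofSuppBddBelow (fun z => x.coeff (n * z)) ⟨min 0 x.order, fun z hz => ?_⟩,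
      ?_⟩
    · have := HahnSeries.order_le_of_coeff_ne_zero hz
      rcases le_or_gt 0 z with h0 | h0
      · exact (min_le_left _ _).trans h0
      · exact (min_le_right _ _).trans (by nlinarith)
    · ext z
      by_cases hz : (n : ℤ) ∣ z
      · obtain ⟨w, rfl⟩ := hz
        rw [coeff_substPow_mul]
        rfl
      · rw [coeff_substPow_of_not_dvd _ _ hz, h z hz]

theorem exists_ofPowerSeries_eq {x : LaurentSeries R} (hx : ∀ z < 0, x.coeff z = 0) :
    ∃ y : R⟦X⟧, HahnSeries.ofPowerSeries ℤ R y = x := by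
  refine ⟨PowerSeries.mk fun n => x.coeff n, ?_⟩
  ext z
  rw [PowerSeries.coeff_coe]
  split_ifs with hz
  · exact (hx z hz).symm
  · rw [PowerSeries.coeff_mk, Int.natAbs_of_nonneg (by omega)]

end SubstPow

variable {k : Type*} [Field k]

/-- `f` has a root in `k((t^{1/n}))` for some `n ≥ 1`. -/
def HasPuiseuxRoot (f : (LaurentSeries k)[X]) : Prop :=
  ∃ (n : ℕ+) (x : LaurentSeries k), f.eval₂ (substPow n) x = 0

namespace HasPuiseuxRoot

variable {f g : (LaurentSeries k)[X]}

theorem of_dvd (h : HasPuiseuxRoot f) (hfg : f ∣ g) : HasPuiseuxRoot g := by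
  obtain ⟨n, x, hx⟩ := h
  exact ⟨n, x, eval₂_eq_zero_of_dvd_of_eval₂_eq_zero _ _ hfg hx⟩

theorem of_taylor {a : LaurentSeries k} (h : HasPuiseuxRoot (taylor a f)) :
    HasPuiseuxRoot f := by
  obtain ⟨n, x, hx⟩ := h
  exact ⟨n, _, by rwa [taylor_apply, eval₂_comp] at hx⟩

theorem of_map {m : ℕ+} (h : HasPuiseuxRoot (f.map (substPow m))) :
    HasPuiseuxRoot f := by
  obtain ⟨n, x, hx⟩ := h
  refine ⟨n * m, x, ?_⟩
  rw [eval₂_map] at hx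
  convert hx using 2
  ext1 y
  simp

theorem of_scaleRoots {u : LaurentSeries k} (hu : u ≠ 0) (h : HasPuiseuxRoot (f.scaleRoots u)) :
    HasPuiseuxRoot f := by
  obtain ⟨n, x, hx⟩ := h
  refine ⟨n, substPow n u⁻¹ * x, ?_⟩
  have := scaleRoots_eval₂_eq_zero (s := u⁻¹) _ hx
  rwa [← scaleRoots_mul, mul_inv_cancel₀ hu, scaleRoots_one] at this

end HasPuiseuxRoot

/-- **Newton–Puiseux**: every nonconstant monic polynomial over `k((t))` has a root in some
`k((t^{1/n}))`. -/
theorem hasPuiseuxRoot_of_monic [IsAlgClosed k] [CharZero k] {f : (LaurentSeries k)[X]}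
    (hf : f.Monic) (hd : f.natDegree ≠ 0) : HasPuiseuxRoot f := by
  induction hn : f.natDegree using Nat.strong_induction_on generalizing f with
  | _ d ih =>
  subst hn
  wlog hsub : f.coeff (f.natDegree - 1) = 0 generalizing f
  · have hchar : CharZero (LaurentSeries k) :=
      charZero_of_injective_algebraMap (algebraMap k (LaurentSeries k)).injective
    have hd' : (f.natDegree : LaurentSeries k) ≠ 0 := by exact_mod_cast hd
    set a : LaurentSeries k := -(f.coeff (f.natDegree - 1) / f.natDegree) with ha
    refine HasPuiseuxRoot.of_taylor (a := a) (this ?_ ?_ ?_ ?_)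
    · simpa [taylor_apply] using hf.comp_X_add_C a
    · simpa using hd
    · simpa using ih
    · rw [natDegree_taylor, coeff_taylor_natDegree_sub_one hf hd, ha, mul_neg,
        mul_div_cancel₀ _ hd', add_neg_cancel]
  by_cases hX : ∀ i < f.natDegree, f.coeff i = 0
  · refine ⟨1, 0, ?_⟩
    rw [eval₂_at_zero, hX 0 (by omega), map_zero]
  push Not at hX
  classical
  -- `i` realizes the smallest slope `ord aᵢ / (d - i)` of the Newton polygon
  obtain ⟨i, hi, hmin⟩ := Finset.exists_min_image
    ((Finset.range f.natDegree).filter fun j => f.coeff j ≠ 0)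
    (fun j => ((f.coeff j).order : ℚ) / ((f.natDegree - j : ℕ) : ℚ))
    (by obtain ⟨j, hj⟩ := hX; exact ⟨j, by simpa using hj⟩)
  simp only [Finset.mem_filter, Finset.mem_range] at hi hmin
  set m : ℕ+ := ⟨f.natDegree - i, by omega⟩ with hm
  set e : ℤ := (f.coeff i).order with he
  have hslope (j : ℕ) (hj : j < f.natDegree) (hj0 : f.coeff j ≠ 0) :
      e * (f.natDegree - j : ℕ) ≤ m * (f.coeff j).order := by
    have h := hmin j ⟨hj, hj0⟩
    rw [div_le_div_iff₀ (by simp; omega) (by simp; omega)] at h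
    rw [mul_comm (m : ℤ)]
    exact_mod_cast h
  set F := (f.map (substPow m)).scaleRoots
    (HahnSeries.single (-e) (1 : k)) with hF
  have hmd : (f.map (substPow m)).natDegree = f.natDegree :=
    hf.natDegree_map _
  have hFm : F.Monic := (monic_scaleRoots_iff _).2 (hf.map _)
  have hFd : F.natDegree = f.natDegree := by rw [hF, natDegree_scaleRoots, hmd]
  have hFc (j : ℕ) (z : ℤ) : (F.coeff j).coeff z =
      (substPow m (f.coeff j)).coeff (z + e * (f.natDegree - j : ℕ)) := by
    have hz : z = (z + e * (f.natDegree - j : ℕ)) + (f.natDegree - j : ℕ) • (-e) := by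
      simp only [smul_neg, nsmul_eq_mul]; ring
    rw [hF, coeff_scaleRoots, hmd, HahnSeries.single_pow, one_pow, Polynomial.coeff_map]
    conv_lhs => rw [hz]
    rw [HahnSeries.coeff_mul_single_add, mul_one]
  obtain ⟨G, hGF, hGd, hGm⟩ := lifts_and_natDegree_eq_and_monic (f := HahnSeries.ofPowerSeries ℤ k)
    (p := F) (by
      rw [lifts_iff_coeff_lifts]
      intro j
      refine exists_ofPowerSeries_eq fun z hz => ?_
      rw [hFc]
      by_cases hjd : f.natDegree ≤ j
      · rw [Nat.sub_eq_zero_of_le hjd, Nat.cast_zero, mul_zero, add_zero]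
        rcases hjd.eq_or_lt with rfl | hlt
        · rw [show f.coeff f.natDegree = 1 from hf, map_one, HahnSeries.coeff_one, if_neg hz.ne]
        · rw [coeff_eq_zero_of_natDegree_lt hlt, map_zero, HahnSeries.coeff_zero]
      · by_cases hdiv : (m : ℤ) ∣ z + e * (f.natDegree - j : ℕ)
        · obtain ⟨w, hw⟩ := hdiv
          rw [hw, coeff_substPow_mul]
          by_contra hne
          have hj0 : f.coeff j ≠ 0 := by rintro h; simp [h] at hne
          have h1 := hslope j (by omega) hj0
          have h2 := HahnSeries.order_le_of_coeff_ne_zero hne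
          have h3 : (0 : ℤ) < m := by simp
          nlinarith
        · exact coeff_substPow_of_not_dvd _ _ hdiv) hFm
  have hGc (j : ℕ) : HahnSeries.ofPowerSeries ℤ k (G.coeff j) = F.coeff j := by
    rw [← hGF, Polynomial.coeff_map]
  have hGd' : G.natDegree = f.natDegree := by rw [hGd, hFd]
  obtain ⟨P, hPm, hPG, hP0, hP1⟩ :=
    PowerSeries.exists_monic_dvd_of_coeff_natDegree_sub_one_eq_zero hGm (by
      apply HahnSeries.ofPowerSeries_injective (Γ := ℤ)
      rw [hGc, map_zero]
      ext z
      rw [hFc, hGd', hsub]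
      simp) ⟨i, by omega, by
        have h0 := PowerSeries.coeff_coe (G.coeff i) 0
        rw [hGc, hFc, zero_add, mul_comm] at h0
        rw [← PowerSeries.coeff_zero_eq_constantCoeff_apply]
        rw [show ((f.natDegree - i : ℕ) : ℤ) = m from rfl, coeff_substPow_mul] at h0
        simp only [lt_self_iff_false, if_false, Int.natAbs_zero] at h0
        rw [← h0]
        exact HahnSeries.coeff_order_eq_zero.not.2 hi.2⟩
  have hPd : (P.map (HahnSeries.ofPowerSeries ℤ k)).natDegree = P.natDegree := hPm.natDegree_map _
  refine HasPuiseuxRoot.of_map (m := m) (HasPuiseuxRoot.of_scaleRoots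
    (u := HahnSeries.single (-e) (1 : k)) (by simp) (HasPuiseuxRoot.of_dvd ?_
      (hGF ▸ Polynomial.map_dvd (HahnSeries.ofPowerSeries ℤ k) hPG)))
  exact ih _ (by omega) (hPm.map _) (by omega) rfl

/-- The extension `k((t^{1/n}))` of `k((t))`, realized as the field of Laurent series with
`k((t))` embedded by `t ↦ tⁿ`. -/
def RootExtension (k : Type*) [Field k] (_n : ℕ+) : Type _ := LaurentSeries k

namespace RootExtension

variable (n : ℕ+)

noncomputable instance : Field (RootExtension k n) := inferInstanceAs (Field (LaurentSeries k))

noncomputable instance : Algebra (LaurentSeries k) (RootExtension k n) :=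
  (substPow n : LaurentSeries k →+* LaurentSeries k).toAlgebra

/-- The identification of `k((t^{1/n}))` with the field of Laurent series. -/
noncomputable def equiv : RootExtension k n ≃+* LaurentSeries k :=
  RingEquiv.refl (LaurentSeries k)

@[simp]
theorem equiv_algebraMap (x : LaurentSeries k) :
    equiv n (algebraMap (LaurentSeries k) (RootExtension k n) x) = substPow n x :=
  rfl

variable {n}

theorem ext_coeff {x y : RootExtension k n} (h : ∀ z, (equiv n x).coeff z = (equiv n y).coeff z) :
    x = y :=
  (equiv n).injective (HahnSeries.ext (funext h))

/-- The action of `kˣ` by rescaling `t^{1/n}`. -/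
noncomputable instance : SMul kˣ (RootExtension k n) where
  smul u x := (equiv n).symm
    { coeff := fun z => ((u ^ z : kˣ) : k) * (equiv n x).coeff z
      isPWO_support' := (equiv n x).isPWO_support.mono fun _ hz => right_ne_zero_of_mul hz }

theorem coeff_smul (u : kˣ) (x : RootExtension k n) (z : ℤ) :
    (equiv n (u • x)).coeff z = ((u ^ z : kˣ) : k) * (equiv n x).coeff z :=
  rfl

theorem support_smul (u : kˣ) (x : RootExtension k n) :
    (equiv n (u • x)).support = (equiv n x).support := by
  ext z
  rw [HahnSeries.mem_support, HahnSeries.mem_support, coeff_smul, ne_eq, Units.mul_right_eq_zero]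

noncomputable instance : MulSemiringAction kˣ (RootExtension k n) where
  one_smul x := ext_coeff fun z => by simp [coeff_smul]
  mul_smul u v x := ext_coeff fun z => by simp [coeff_smul, mul_zpow, mul_assoc]
  smul_zero u := ext_coeff fun z => by simp [coeff_smul]
  smul_add u x y := ext_coeff fun z => by simp [coeff_smul, mul_add]
  smul_one u := ext_coeff fun z => by
    rw [coeff_smul, map_one, HahnSeries.coeff_one]
    split_ifs with hz <;> simp [hz]
  smul_mul u x y := ext_coeff fun z => by
    rw [coeff_smul, map_mul, map_mul, HahnSeries.coeff_mul, HahnSeries.coeff_mul, Finset.mul_sum]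
    refine Finset.sum_congr (by ext; simp [support_smul]) fun ij hij => ?_
    have hz : ij.1 + ij.2 = z := by simpa using (Finset.mem_antidiagonal.1 hij).2.2
    rw [coeff_smul, coeff_smul, ← hz, zpow_add, Units.val_mul]
    ring

theorem smul_eq_self_iff (u : kˣ) (x : RootExtension k n) :
    u • x = x ↔ ∀ z : ℤ, ¬ (orderOf u : ℤ) ∣ z → (equiv n x).coeff z = 0 := by
  constructor
  · intro h z hz
    have h' := coeff_smul u x z
    rw [h] at h'
    by_contra hx
    exact hz (orderOf_dvd_iff_zpow_eq_one.2 (Units.ext (mul_right_cancel₀ hx (by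
      rw [← h', Units.val_one, one_mul]))))
  · intro h
    refine ext_coeff fun z => ?_
    by_cases hz : (orderOf u : ℤ) ∣ z
    · rw [coeff_smul, orderOf_dvd_iff_zpow_eq_one.1 hz, Units.val_one, one_mul]
    · rw [coeff_smul, h z hz, mul_zero]

theorem forall_smul_eq_self_iff (H : Subgroup kˣ) [Finite H] {m : ℕ+} (hm : Nat.card H = m)
    (x : RootExtension k n) :
    (∀ u ∈ H, u • x = x) ↔ equiv n x ∈ Set.range (substPow (R := k) m) := by
  rw [mem_range_substPow_iff]
  constructor
  · intro h
    obtain ⟨g, hg⟩ := IsCyclic.exists_generator (α := H)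
    have ho : orderOf (g : kˣ) = m := by
      rw [Subgroup.orderOf_coe, orderOf_eq_card_of_forall_mem_zpowers hg, hm]
    simpa only [ho] using (smul_eq_self_iff (g : kˣ) x).1 (h g g.2)
  · intro h u hu
    refine (smul_eq_self_iff u x).2 fun z hz => h z fun hmz => hz (dvd_trans ?_ hmz)
    rw [← hm]
    exact_mod_cast Subgroup.orderOf_dvd_natCard H hu

variable [IsAlgClosed k] [CharZero k]

instance : IsGaloisGroup (rootsOfUnity n k) (LaurentSeries k) (RootExtension k n) where
  faithful := ⟨fun {u v} h => by
    have h' := congrArg (fun y => (equiv n y).coeff 1) (h ((equiv n).symm (HahnSeries.single 1 1)))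
    simp only [Subgroup.smul_def, coeff_smul, RingEquiv.apply_symm_apply, zpow_one,
      HahnSeries.coeff_single_same, mul_one] at h'
    exact Subtype.ext (Units.ext h')⟩
  commutes := ⟨fun u a x => by
    rw [Algebra.smul_def, Algebra.smul_def, smul_mul']
    congr 1
    rw [Subgroup.smul_def]
    exact (forall_smul_eq_self_iff (rootsOfUnity n k)
      (HasEnoughRootsOfUnity.natCard_rootsOfUnity k n) _).2 ⟨a, rfl⟩ u u.2⟩
  isInvariant := ⟨fun x h => by
    obtain ⟨a, ha⟩ := (forall_smul_eq_self_iff (rootsOfUnity n k)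
      (HasEnoughRootsOfUnity.natCard_rootsOfUnity k n) x).1 fun u hu => h ⟨u, hu⟩
    exact ⟨a, ha⟩⟩

theorem finrank_eq : Module.finrank (LaurentSeries k) (RootExtension k n) = n := by
  rw [← IsGaloisGroup.card_eq_finrank (rootsOfUnity n k),
    HasEnoughRootsOfUnity.natCard_rootsOfUnity]

end RootExtension

variable [IsAlgClosed k] [CharZero k] (L : Type*) [Field L] [Algebra (LaurentSeries k) L]
  [FiniteDimensional (LaurentSeries k) L]

/-- Every finite extension of `k((t))` embeds into some `k((t^{1/n}))`. -/
theorem exists_algHom_rootExtension :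
    ∃ n : ℕ+, Nonempty (L →ₐ[LaurentSeries k] RootExtension k n) := by
  have : CharZero (LaurentSeries k) :=
    charZero_of_injective_algebraMap (algebraMap k (LaurentSeries k)).injective
  let pb := Field.powerBasisOfFiniteOfSeparable (LaurentSeries k) L
  obtain ⟨n, x, hx⟩ := hasPuiseuxRoot_of_monic (minpoly.monic pb.isIntegral_gen)
    (minpoly.natDegree_pos pb.isIntegral_gen).ne'
  exact ⟨n, ⟨pb.lift ((RootExtension.equiv n).symm x) hx⟩⟩

/-- A finite extension `L` of `k((t))` of degree `d` is isomorphic to `k((t^{1/d}))`. -/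
theorem exists_ringEquiv_algebraMap_eq_substPow :
    ∃ (d : ℕ+) (e : L ≃+* LaurentSeries k), Module.finrank (LaurentSeries k) L = d ∧
      ∀ x, e (algebraMap (LaurentSeries k) L x) = substPow d x := by
  obtain ⟨n, ⟨j⟩⟩ := exists_algHom_rootExtension (k := k) L
  let F : IntermediateField (LaurentSeries k) (RootExtension k n) := j.fieldRange
  let H : Subgroup (rootsOfUnity n k) := fixingSubgroup (rootsOfUnity n k) (F : Set (RootExtension k n))
  let H' : Subgroup kˣ := H.map (rootsOfUnity n k).subtype
  have : Finite H' := ((H : Set (rootsOfUnity n k)).toFinite.image _).to_subtype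
  let d : ℕ+ := ⟨Module.finrank (LaurentSeries k) L, Module.finrank_pos⟩
  let m : ℕ+ := ⟨Nat.card H', Nat.card_pos⟩
  have hdm : n = m * d := by
    have hF : Module.finrank (LaurentSeries k) F = d :=
      j.equivFieldRange.toLinearEquiv.finrank_eq.symm
    have hH : Nat.card H = m :=
      (Subgroup.card_map_of_injective (Subgroup.subtype_injective _)).symm
    have h := Module.finrank_mul_finrank (LaurentSeries k) F (RootExtension k n)
    rw [RootExtension.finrank_eq, hF,
      ← IsGaloisGroup.card_fixingSubgroup_eq_finrank (rootsOfUnity n k), hH] at h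
    rw [← PNat.coe_inj, PNat.mul_coe, mul_comm]
    exact h.symm
  have hrange (y : RootExtension k n) :
      y ∈ F ↔ RootExtension.equiv n y ∈ Set.range (substPow (R := k) m) := by
    rw [← RootExtension.forall_smul_eq_self_iff H' rfl,
      ← IsGaloisGroup.fixedPoints_fixingSubgroup (rootsOfUnity n k) _ _ F]
    constructor
    · rintro h _ ⟨u, hu, rfl⟩
      exact h ⟨u, hu⟩
    · rintro h ⟨u, hu⟩
      exact h u ⟨u, hu, rfl⟩
  let i : L →+* LaurentSeries k := (RootExtension.equiv n).toRingHom.comp j.toRingHom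
  have hmem (y : L) : i y ∈ (substPow (R := k) m).range :=
    (hrange (j y)).1 ⟨y, rfl⟩
  let σ := RingEquiv.ofBijective (substPow (R := k) m).rangeRestrict
    ⟨fun x y h => (substPow (R := k) m).injective (congrArg Subtype.val h),
      (substPow (R := k) m).rangeRestrict_surjective⟩
  let τ := RingEquiv.ofBijective (i.codRestrict (substPow (R := k) m).range hmem)
    ⟨fun x y h => i.injective (congrArg Subtype.val h), by
      rintro ⟨y, hy⟩
      obtain ⟨x, hx⟩ := (hrange ((RootExtension.equiv n).symm y)).2 (by simpa using hy)
      refine ⟨x, Subtype.ext ?_⟩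
      change RootExtension.equiv n (j x) = y
      rw [show j x = _ from hx, RingEquiv.apply_symm_apply]⟩
  refine ⟨d, τ.trans σ.symm, rfl, fun x => ?_⟩
  rw [RingEquiv.trans_apply, RingEquiv.symm_apply_eq]
  refine Subtype.ext ?_
  change RootExtension.equiv n (j (algebraMap _ _ x)) = substPow m (substPow d x)
  rw [substPow_substPow, ← hdm, j.commutes, RootExtension.equiv_algebraMap]

theorem isCyclic_gal [IsGalois (LaurentSeries k) L] : IsCyclic Gal(L/LaurentSeries k) := by
  obtain ⟨n, ⟨j⟩⟩ := exists_algHom_rootExtension (k := k) L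
  let : Algebra L (RootExtension k n) := j.toRingHom.toAlgebra
  have : IsScalarTower (LaurentSeries k) L (RootExtension k n) :=
    IsScalarTower.of_algebraMap_eq fun x => (j.commutes x).symm
  exact isCyclic_of_surjective _ (IsGaloisGroup.restrictHom_surjective (rootsOfUnity n k)
    Gal(L/LaurentSeries k) (LaurentSeries k) L (RootExtension k n))

end LaurentSeries

/-- Puiseux's theorem for `ℂ((t))`: the algebraic closure of `ℂ((t))` is the union of the
fields `ℂ((t^{1/n}))`; every finite extension of `ℂ((t))` is of the form `ℂ((t^{1/n}))`
(i.e. is isomorphic to `ℂ((s))` with `t ↦ sⁿ`, `n` the degree); and every finite Galois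
extension of `ℂ((t))` has cyclic Galois group. -/
theorem puiseux_laurentSeries :
    (∀ x : AlgebraicClosure (LaurentSeries ℂ),
      ∃ (n : ℕ) (φ : LaurentSeries ℂ →ₐ[ℂ] AlgebraicClosure (LaurentSeries ℂ)),
        0 < n ∧
        φ (HahnSeries.single (1 : ℤ) (1 : ℂ)) ^ n =
          algebraMap (LaurentSeries ℂ) (AlgebraicClosure (LaurentSeries ℂ))
            (HahnSeries.single (1 : ℤ) (1 : ℂ)) ∧
        x ∈ Set.range φ) ∧
    (∀ (L : Type) [Field L] [Algebra (LaurentSeries ℂ) L],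
      FiniteDimensional (LaurentSeries ℂ) L →
      ∃ e : L ≃+* LaurentSeries ℂ,
        e (algebraMap (LaurentSeries ℂ) L (HahnSeries.single (1 : ℤ) (1 : ℂ))) =
          HahnSeries.single ((Module.finrank (LaurentSeries ℂ) L : ℤ)) (1 : ℂ)) ∧
    (∀ (L : Type) [Field L] [Algebra (LaurentSeries ℂ) L],
      FiniteDimensional (LaurentSeries ℂ) L → IsGalois (LaurentSeries ℂ) L →
      IsCyclic (L ≃ₐ[LaurentSeries ℂ] L)) := by
  refine ⟨fun x => ?_, fun L _ _ _ => ?_, fun L _ _ _ _ => LaurentSeries.isCyclic_gal L⟩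
  · let E := IntermediateField.adjoin (LaurentSeries ℂ) {x}
    have : FiniteDimensional (LaurentSeries ℂ) E :=
      IntermediateField.adjoin.finiteDimensional (Algebra.IsIntegral.isIntegral x)
    obtain ⟨d, e, -, he⟩ := LaurentSeries.exists_ringEquiv_algebraMap_eq_substPow (k := ℂ) E
    have hφ (y : LaurentSeries ℂ) : algebraMap E (AlgebraicClosure (LaurentSeries ℂ))
        (e.symm (LaurentSeries.substPow d y)) = algebraMap _ _ y := by
      rw [← he, e.symm_apply_apply, ← IsScalarTower.algebraMap_apply]
    refine ⟨d, { (algebraMap E _).comp (e.symm : LaurentSeries ℂ →+* E) with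
      commutes' := fun c => ?_ }, d.pos, ?_, ?_⟩
    · have := hφ (algebraMap ℂ _ c)
      rw [LaurentSeries.substPow_algebraMap, ← IsScalarTower.algebraMap_apply] at this
      exact this
    · rw [← map_pow, HahnSeries.single_pow, one_pow, ← hφ, LaurentSeries.substPow_single,
        mul_one, nsmul_eq_mul, mul_one]
      rfl
    · exact ⟨e ⟨x, IntermediateField.mem_adjoin_simple_self _ x⟩,
        congrArg Subtype.val (e.symm_apply_apply _)⟩
  · obtain ⟨d, e, hd, he⟩ := LaurentSeries.exists_ringEquiv_algebraMap_eq_substPow (k := ℂ) L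
    exact ⟨e, by rw [he, hd, LaurentSeries.substPow_single, mul_one]⟩
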